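/- (Theorem 3.5, part II: local controllability with respect to a submersion.) Let U ⊆ ℝ^m be convex, compact, with 0 ∈ U. Let t_f > 0, let x̄(t) = φ⁰(t, x̄₀) for t ∈ [0,t_f] be the drift solution starting at x̄₀ ∈ ℝ^d, and set Ē = E^U_{[0,t_f]}(x̄₀). Let π : ℝ^d → ℝⁿ (n ≤ d) be a C^∞ map whose derivative Dπ(x) is surjective at every x. If the linear map Dπ(φ⁰(t_f,x̄₀)) ∘ D_xφ⁰(t_f,·)(x̄₀) maps cone Ē onto all of ℝⁿ, then for every ε > 0 the set π(A^{εU}_{t_f}(x̄₀)) is a neighborhood of π(x̄(t_f)) in ℝⁿ, where εU = {εu : u ∈ U}. -/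

import Mathlib

open Set MeasureTheory
open scoped Pointwise

noncomputable section

/-- `ℝ^d` as a Euclidean space. -/
abbrev Ed (d : ℕ) := EuclideanSpace ℝ (Fin d)

/-- Conic hull of a set: all finite conic combinations of elements of `S`. -/
def coneHull {V : Type*} [AddCommMonoid V] [Module ℝ V] (S : Set V) : Set V :=
  {y | ∃ (j : ℕ) (v : Fin j → V) (c : Fin j → ℝ),
    (∀ i, v i ∈ S) ∧ (∀ i, 0 ≤ c i) ∧ y = ∑ i, c i • v i}

/-- `(x, u)` is a solution of the affine control system
`ẋ = X⁰(x) + ∑ u_k X^k(x)` on `[0, tf]` with control constrained to `U`: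
`u` is measurable, `U`-valued and essentially bounded on `[0,tf]`, and `x` is
absolutely continuous, given as the integral of the right-hand side. -/
def IsSol {d m : ℕ} (X0 : Ed d → Ed d) (X : Fin m → Ed d → Ed d)
    (U : Set (Fin m → ℝ)) (tf : ℝ) (x : ℝ → Ed d) (u : ℝ → Fin m → ℝ) : Prop :=
  Measurable u ∧ (∀ t ∈ Icc (0:ℝ) tf, u t ∈ U) ∧
    (∃ C, ∀ t ∈ Icc (0:ℝ) tf, ‖u t‖ ≤ C) ∧
    IntervalIntegrable (fun s => X0 (x s) + ∑ k, u s k • X k (x s)) volume 0 tf ∧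
    ∀ t ∈ Icc (0:ℝ) tf, x t = x 0 + ∫ s in (0:ℝ)..t, (X0 (x s) + ∑ k, u s k • X k (x s))

/-- The accessible set `A^U_{tf}(x₀)`. -/
def Access {d m : ℕ} (X0 : Ed d → Ed d) (X : Fin m → Ed d → Ed d)
    (U : Set (Fin m → ℝ)) (tf : ℝ) (x0 : Ed d) : Set (Ed d) :=
  {y | ∃ x u, IsSol X0 X U tf x u ∧ x 0 = x0 ∧ x tf = y}

/-- Pushforward `(exp(−τX⁰)_* Z)(x)` of the vector field `Z` along the flow `φ` of `X⁰`. -/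
def pushf {d : ℕ} (φ : ℝ → Ed d → Ed d) (Z : Ed d → Ed d) (τ : ℝ) (x : Ed d) : Ed d :=
  fderiv ℝ (φ (-τ)) (φ τ x) (Z (φ τ x))

/-- The set `E^U_τ(x)`. -/
def EsetAt {d m : ℕ} (φ : ℝ → Ed d → Ed d) (X : Fin m → Ed d → Ed d)
    (U : Set (Fin m → ℝ)) (τ : ℝ) (x : Ed d) : Set (Ed d) :=
  {v | ∃ u ∈ U, v = ∑ k, u k • pushf φ (X k) τ x}

/-- The set `E^U_{[t₁,t₂]}(x)`. -/
def EIcc {d m : ℕ} (φ : ℝ → Ed d → Ed d) (X : Fin m → Ed d → Ed d)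
    (U : Set (Fin m → ℝ)) (t₁ t₂ : ℝ) (x : Ed d) : Set (Ed d) :=
  ⋃ τ ∈ Icc t₁ t₂, EsetAt φ X U τ x

open Filter Metric ODE in
/-- Picard–Lindelöf, recording that the solution stays in the ball where the hypotheses hold. -/
theorem IsPicardLindelof.exists_hasDerivWithinAt_mem_closedBall
    {E : Type*} [NormedAddCommGroup E] [NormedSpace ℝ E] [CompleteSpace E]
    {f : ℝ → E → E} {tmin tmax : ℝ} {t₀ : Icc tmin tmax} {x₀ x : E} {a r L K : NNReal}
    (hf : IsPicardLindelof f t₀ x₀ a r L K) (hx : x ∈ closedBall x₀ r) :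
    ∃ α : ℝ → E, α t₀ = x ∧ (∀ t, α t ∈ closedBall x₀ a) ∧
      ∀ t ∈ Icc tmin tmax, HasDerivWithinAt α (f t (α t)) (Icc tmin tmax) t := by
  obtain ⟨α, hα⟩ := FunSpace.exists_isFixedPt_next hf hx
  refine ⟨α.compProj, by rw [FunSpace.compProj_val, ← hα, FunSpace.next_apply₀],
    fun t ↦ α.compProj_mem_closedBall hf.mul_max_le, fun t ht ↦ ?_⟩
  apply hasDerivWithinAt_picard_Icc t₀.2 hf.continuousOn_uncurry
    α.continuous_compProj.continuousOn (fun _ ht' ↦ α.compProj_mem_closedBall hf.mul_max_le)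
    x ht |>.congr_of_mem _ ht
  intro t' ht'
  nth_rw 1 [← hα]
  rw [FunSpace.compProj_of_mem ht', FunSpace.next_apply]

section ParameterDependence

variable {Λ E : Type*} [NormedAddCommGroup Λ] [NormedSpace ℝ Λ]
  [NormedAddCommGroup E] [NormedSpace ℝ E]

open Metric

/-- Solvability on `[0, T]` of `y' = G t y l` for all small parameters `l`. -/
theorem exists_trajectory_of_small_parameter [CompleteSpace E]
    (G : ℝ → E → Λ →L[ℝ] E) (x₀ : E) {T : ℝ} (hT : 0 < T)
    (hG : ∀ y, Continuous fun t => G t y) (M K : NNReal)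
    (hM : ∀ t ∈ Icc 0 T, ∀ y ∈ closedBall x₀ 1, ‖G t y‖ ≤ M)
    (hK : ∀ t ∈ Icc 0 T, LipschitzOnWith K (G t) (closedBall x₀ 1))
    (l : Λ) (hl : M * ‖l‖ * T ≤ 1) :
    ∃ y : ℝ → E, y 0 = x₀ ∧ (∀ t, y t ∈ closedBall x₀ 1) ∧
      ∀ t ∈ Icc 0 T, HasDerivWithinAt y (G t (y t) l) (Icc 0 T) t := by
  have hPL : IsPicardLindelof (fun t y => G t y l) (tmin := 0) (tmax := T)
      ⟨0, left_mem_Icc.2 hT.le⟩ x₀ 1 0 (M * ‖l‖₊) (K * ‖l‖₊) := by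
    refine ⟨fun t ht => ?_, fun y _ => ?_, fun t ht y hy => ?_, ?_⟩
    · refine LipschitzOnWith.of_dist_le_mul fun y hy z hz => ?_
      rw [dist_eq_norm, ← sub_apply]
      have h1 := (hK t ht).dist_le_mul y hy z hz
      rw [dist_eq_norm] at h1
      calc _ ≤ ‖G t y - G t z‖ * ‖l‖ := ContinuousLinearMap.le_opNorm _ _
        _ ≤ K * dist y z * ‖l‖ := by gcongr
        _ = _ := by push_cast; ring
    · exact ((hG y).clm_apply continuous_const).continuousOn
    · refine (ContinuousLinearMap.le_opNorm _ _).trans ?_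
      push_cast
      gcongr
      exact hM t ht y hy
    · simpa [hT.le] using hl
  simpa using hPL.exists_hasDerivWithinAt_mem_closedBall (x := x₀) (by simp)

/-- Trajectories of `y' = G t y l` starting from the same point depend on the parameter
in a Lipschitz way, as long as one of the parameters is small. -/
theorem norm_trajectory_sub_le (G : ℝ → E → Λ →L[ℝ] E) (x₀ : E) {T : ℝ} (hT : 0 < T)
    (M K : NNReal)
    (hM : ∀ t ∈ Icc 0 T, ∀ y ∈ closedBall x₀ 1, ‖G t y‖ ≤ M)
    (hK : ∀ t ∈ Icc 0 T, LipschitzOnWith K (G t) (closedBall x₀ 1))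
    {l l' : Λ} (hl' : 2 * T * K * ‖l'‖ ≤ 1) {y y' : ℝ → E} (h0 : y 0 = x₀) (h0' : y' 0 = x₀)
    (hmem : ∀ t, y t ∈ closedBall x₀ 1) (hmem' : ∀ t, y' t ∈ closedBall x₀ 1)
    (hy : ∀ t ∈ Icc 0 T, HasDerivWithinAt y (G t (y t) l) (Icc 0 T) t)
    (hy' : ∀ t ∈ Icc 0 T, HasDerivWithinAt y' (G t (y' t) l') (Icc 0 T) t) :
    ∀ t ∈ Icc 0 T, ‖y t - y' t‖ ≤ 2 * T * M * ‖l - l'‖ := by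
  have hcont : ContinuousOn (fun t => ‖y t - y' t‖) (Icc 0 T) := fun t ht =>
    ((hy t ht).continuousWithinAt.sub (hy' t ht).continuousWithinAt).norm
  obtain ⟨s, hs, hmax⟩ := isCompact_Icc.exists_isMaxOn ⟨0, left_mem_Icc.2 hT.le⟩ hcont
  set D := ‖y s - y' s‖ with hD
  have hmax' : ∀ t ∈ Icc 0 T, ‖y t - y' t‖ ≤ D := fun t ht => hmax ht
  have hder : ∀ t ∈ Icc 0 T, HasDerivWithinAt (fun t => y t - y' t)
      (G t (y t) l - G t (y' t) l') (Icc 0 T) t := fun t ht => (hy t ht).sub (hy' t ht)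
  have hbound : ∀ t ∈ Icc 0 T,
      ‖G t (y t) l - G t (y' t) l'‖ ≤ M * ‖l - l'‖ + K * D * ‖l'‖ := by
    intro t ht
    have h1 := (hK t ht).dist_le_mul _ (hmem t) _ (hmem' t)
    rw [dist_eq_norm, dist_eq_norm] at h1
    calc _ = ‖G t (y t) (l - l') + (G t (y t) - G t (y' t)) l'‖ := by simp
      _ ≤ ‖G t (y t)‖ * ‖l - l'‖ + ‖G t (y t) - G t (y' t)‖ * ‖l'‖ :=
        norm_add_le_of_le (ContinuousLinearMap.le_opNorm _ _) (ContinuousLinearMap.le_opNorm _ _)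
      _ ≤ M * ‖l - l'‖ + K * ‖y t - y' t‖ * ‖l'‖ := by
        gcongr
        exact hM t ht _ (hmem t)
      _ ≤ _ := by gcongr; exact hmax' t ht
  have key := norm_image_sub_le_of_norm_deriv_le_segment' hder
    (fun t ht => hbound t (Ico_subset_Icc_self ht)) s hs
  simp only [h0, h0', sub_self, sub_zero] at key
  rw [← hD] at key
  have hD0 : 0 ≤ D := norm_nonneg _
  have h2 : D ≤ (M * ‖l - l'‖ + K * D * ‖l'‖) * T :=
    key.trans (mul_le_mul_of_nonneg_left hs.2 (by positivity))
  have h3 : 2 * T * K * ‖l'‖ * D ≤ 1 * D := mul_le_mul_of_nonneg_right hl' hD0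
  intro t ht
  refine (hmax' t ht).trans ?_
  linarith

/-- The endpoint of the solution of `y' = G t y l`, `y 0 = x₀` is strictly differentiable with
respect to the parameter `l` at `0`. -/
theorem exists_trajectories_hasStrictFDerivAt [CompleteSpace E]
    (G : ℝ → E → Λ →L[ℝ] E) (x₀ : E) {T : ℝ} (hT : 0 < T)
    (hG : ∀ y, Continuous fun t => G t y) (M K : NNReal)
    (hM : ∀ t ∈ Icc 0 T, ∀ y ∈ closedBall x₀ 1, ‖G t y‖ ≤ M)
    (hK : ∀ t ∈ Icc 0 T, LipschitzOnWith K (G t) (closedBall x₀ 1)) :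
    ∃ r > 0, ∃ Y : Λ → ℝ → E,
      (∀ l, ‖l‖ ≤ r → Y l 0 = x₀ ∧ (∀ t, Y l t ∈ closedBall x₀ 1) ∧
        ∀ t ∈ Icc 0 T, HasDerivWithinAt (Y l) (G t (Y l t) l) (Icc 0 T) t) ∧
      Y 0 T = x₀ ∧
      HasStrictFDerivAt (fun l => Y l T) (∫ t in (0 : ℝ)..T, G t x₀) 0 := by
  classical
  obtain ⟨r, hr, hr1, hr2⟩ : ∃ r > 0, M * r * T ≤ 1 ∧ 2 * T * K * r ≤ 1 := by
    refine ⟨(M * T + 2 * T * K + 1)⁻¹, by positivity, ?_, ?_⟩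
    · rw [mul_right_comm, ← div_eq_mul_inv, div_le_one (by positivity)]
      have : 0 ≤ 2 * T * K := by positivity
      linarith
    · rw [← div_eq_mul_inv, div_le_one (by positivity)]
      have : 0 ≤ M * T := by positivity
      linarith
  have hsmall1 : ∀ l : Λ, ‖l‖ ≤ r → M * ‖l‖ * T ≤ 1 := fun l hl => le_trans (by gcongr) hr1
  have hsmall2 : ∀ l : Λ, ‖l‖ ≤ r → 2 * T * K * ‖l‖ ≤ 1 := fun l hl => le_trans (by gcongr) hr2
  have hex : ∀ l : Λ, ∃ y : ℝ → E, ‖l‖ ≤ r → y 0 = x₀ ∧ (∀ t, y t ∈ closedBall x₀ 1) ∧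
      ∀ t ∈ Icc 0 T, HasDerivWithinAt y (G t (y t) l) (Icc 0 T) t := by
    intro l
    by_cases hl : ‖l‖ ≤ r
    · obtain ⟨y, hy⟩ := exists_trajectory_of_small_parameter G x₀ hT hG M K hM hK l (hsmall1 l hl)
      exact ⟨y, fun _ => hy⟩
    · exact ⟨0, fun h => absurd h hl⟩
  choose Y hY using hex
  have hx₀ : x₀ ∈ closedBall x₀ 1 := mem_closedBall_self zero_le_one
  have hdist : ∀ l, ‖l‖ ≤ r → ∀ t ∈ Icc 0 T, ‖Y l t - x₀‖ ≤ 2 * T * M * ‖l‖ := by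
    intro l hl t ht
    obtain ⟨h1, h2, h3⟩ := hY l hl
    have := norm_trajectory_sub_le G x₀ hT M K hM hK (l' := 0) (by simp) h1
      (y' := fun _ => x₀) rfl h2 (fun _ => hx₀) h3
      (fun t _ => by simpa using hasDerivWithinAt_const t (Icc 0 T) x₀) t ht
    simpa using this
  refine ⟨r, hr, Y, hY, ?_, ?_⟩
  · simpa [sub_eq_zero] using hdist 0 (by simpa using hr.le) T (right_mem_Icc.2 hT.le)
  rw [hasStrictFDerivAt_iff_isLittleO, Asymptotics.isLittleO_iff]
  intro c hc
  set C : ℝ := 4 * T * T * M * K + 1 with hC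
  have hCpos : 0 < C := by positivity
  set ρ : ℝ := min r (c / C) with hρ
  have hρpos : 0 < ρ := lt_min hr (by positivity)
  have hball : closedBall (0 : Λ) ρ ×ˢ closedBall (0 : Λ) ρ ∈ nhds ((0 : Λ), (0 : Λ)) :=
    prod_mem_nhds (closedBall_mem_nhds _ hρpos) (closedBall_mem_nhds _ hρpos)
  filter_upwards [hball] with p hp
  obtain ⟨l, l'⟩ := p
  simp only [mem_prod, mem_closedBall, dist_zero_right] at hp
  obtain ⟨hl, hl'⟩ := hp
  have hlr : ‖l‖ ≤ r := hl.trans (min_le_left _ _)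
  have hlr' : ‖l'‖ ≤ r := hl'.trans (min_le_left _ _)
  obtain ⟨h1, h2, h3⟩ := hY l hlr
  obtain ⟨h1', h2', h3'⟩ := hY l' hlr'
  have hlip := norm_trajectory_sub_le G x₀ hT M K hM hK (hsmall2 l' hlr') h1 h1' h2 h2' h3 h3'
  have hint : ∀ t, HasDerivAt (fun t => (∫ s in (0 : ℝ)..t, G s x₀) (l - l'))
      (G t x₀ (l - l')) t := fun t => by
      have h := intervalIntegral.integral_hasDerivAt_right ((hG x₀).intervalIntegrable 0 t)
        ((hG x₀).stronglyMeasurableAtFilter _ _) (hG x₀).continuousAt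
      simpa using h.clm_apply (hasDerivAt_const t (l - l'))
  have hder : ∀ t ∈ Icc 0 T, HasDerivWithinAt
      (fun t => Y l t - Y l' t - (∫ s in (0 : ℝ)..t, G s x₀) (l - l'))
      (G t (Y l t) l - G t (Y l' t) l' - G t x₀ (l - l')) (Icc 0 T) t := fun t ht =>
    ((h3 t ht).sub (h3' t ht)).sub (hint t).hasDerivWithinAt
  have hbound : ∀ t ∈ Icc 0 T, ‖G t (Y l t) l - G t (Y l' t) l' - G t x₀ (l - l')‖ ≤
      4 * T * M * K * ρ * ‖l - l'‖ := by
    intro t ht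
    have e1 := (hK t ht).dist_le_mul _ (h2 t) _ hx₀
    have e2 := (hK t ht).dist_le_mul _ (h2 t) _ (h2' t)
    rw [dist_eq_norm, dist_eq_norm] at e1 e2
    calc _ = ‖(G t (Y l t) - G t x₀) (l - l') + (G t (Y l t) - G t (Y l' t)) l'‖ := by
          simp only [sub_apply, map_sub]; congr 1; abel
      _ ≤ ‖G t (Y l t) - G t x₀‖ * ‖l - l'‖ + ‖G t (Y l t) - G t (Y l' t)‖ * ‖l'‖ :=
        norm_add_le_of_le (ContinuousLinearMap.le_opNorm _ _) (ContinuousLinearMap.le_opNorm _ _)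
      _ ≤ K * (2 * T * M * ρ) * ‖l - l'‖ + K * (2 * T * M * ‖l - l'‖) * ρ := by
        gcongr
        · exact e1.trans (by gcongr; exact (hdist l hlr t ht).trans (by gcongr))
        · exact e2.trans (by gcongr; exact hlip t ht)
      _ = _ := by ring
  have key := norm_image_sub_le_of_norm_deriv_le_segment' hder
    (fun t ht => hbound t (Ico_subset_Icc_self ht)) T (right_mem_Icc.2 hT.le)
  simp only [h1, h1', sub_self, sub_zero, intervalIntegral.integral_same,
    zero_apply] at key
  refine key.trans ?_
  have hρc : C * ρ ≤ c := by
    have := min_le_right r (c / C)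
    rwa [← hρ, le_div_iff₀ hCpos, mul_comm] at this
  calc _ = (4 * T * T * M * K) * ρ * ‖l - l'‖ := by ring
    _ ≤ C * ρ * ‖l - l'‖ := by gcongr; linarith
    _ ≤ _ := by gcongr

end ParameterDependence

section ConvexCone

variable {W : Type*} [AddCommGroup W] [Module ℝ W]

theorem Convex.sum_mem_sum_smul {ι : Type*} {U : Set W} (hU : Convex ℝ U) (h0 : (0 : W) ∈ U)
    (s : Finset ι) (c : ι → ℝ) (a : ι → W) (hc : ∀ i ∈ s, 0 ≤ c i) (ha : ∀ i ∈ s, a i ∈ c i • U) :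
    ∑ i ∈ s, a i ∈ (∑ i ∈ s, c i) • U := by
  classical
  induction s using Finset.induction_on with
  | empty => simpa using ⟨0, h0, by simp⟩
  | insert i s hi ih =>
    simp only [Finset.mem_insert, forall_eq_or_imp] at hc ha
    rw [Finset.sum_insert hi, Finset.sum_insert hi,
      hU.add_smul hc.1 (Finset.sum_nonneg hc.2)]
    exact Set.add_mem_add ha.1 (ih hc.2 ha.2)

theorem Convex.smul_subset_smul_of_le {U : Set W} (hU : Convex ℝ U) (h0 : (0 : W) ∈ U)
    {a b : ℝ} (ha : 0 ≤ a) (hab : a ≤ b) : a • U ⊆ b • U := by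
  intro x hx
  have := hU.add_smul ha (sub_nonneg.2 hab)
  rw [add_sub_cancel] at this
  rw [this]
  exact ⟨x, hx, 0, ⟨0, h0, smul_zero _⟩, add_zero _⟩

end ConvexCone

section ApproximateCone

variable {W F : Type*} [NormedAddCommGroup W] [NormedSpace ℝ W]
  [NormedAddCommGroup F] [NormedSpace ℝ F] [CompleteSpace F]

/-- A multiple of a value `f τ u` is approximated by integrating `f` against a scalar bump
concentrated near `τ`, times `u`. -/
theorem exists_continuous_integral_approx_smul (f : ℝ → W →L[ℝ] F) (hf : Continuous f)
    {U : Set W} (hU : Convex ℝ U) (h0 : (0 : W) ∈ U) {T : ℝ} (hT : 0 < T)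
    {τ : ℝ} (hτ : τ ∈ Icc 0 T) {u : W} (hu : u ∈ U) {c : ℝ} (hc : 0 ≤ c) {η : ℝ} (hη : 0 < η) :
    ∃ (v : ℝ → W) (C : ℝ), Continuous v ∧ 0 ≤ C ∧ (∀ t, v t ∈ C • U) ∧
      ‖(∫ t in (0 : ℝ)..T, f t (v t)) - c • f τ u‖ ≤ η := by
  have hfu : Continuous fun t => f t u := hf.clm_apply continuous_const
  obtain ⟨δ, hδ, hδf⟩ := Metric.continuousAt_iff.1 (hfu.continuousAt (x := τ)) (η / (c + 1))
    (by positivity)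
  set ρ : ℝ → ℝ := fun t => max 0 (δ - |t - τ|) with hρ
  have hρc : Continuous ρ := by fun_prop
  have hρ0 : ∀ t, 0 ≤ ρ t := fun t => le_max_left _ _
  have hρδ : ∀ t, ρ t ≤ δ := fun t => max_le hδ.le (by linarith [abs_nonneg (t - τ)])
  set I := ∫ t in (0 : ℝ)..T, ρ t with hI
  have hIpos : 0 < I := intervalIntegral.integral_pos hT hρc.continuousOn (fun t _ => hρ0 t)
    ⟨τ, hτ, by simp [hρ, hδ]⟩
  refine ⟨fun t => (c * ρ t / I) • u, c * δ / I, by fun_prop, by positivity, fun t => ?_, ?_⟩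
  · refine hU.smul_subset_smul_of_le h0 (a := c * ρ t / I) ?_ ?_ (smul_mem_smul_set hu)
    · have := hρ0 t
      positivity
    · gcongr
      exact hρδ t
  have hmass : ∫ t in (0 : ℝ)..T, c * ρ t / I = c := by
    rw [intervalIntegral.integral_div, intervalIntegral.integral_const_mul, ← hI]
    field_simp
  have hint1 : Continuous fun t => f t ((c * ρ t / I) • u) := hf.clm_apply (by fun_prop)
  have hint2 : Continuous fun t => (c * ρ t / I) • f τ u := by fun_prop
  have hsub : (∫ t in (0 : ℝ)..T, f t ((c * ρ t / I) • u)) - c • f τ u =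
      ∫ t in (0 : ℝ)..T, (f t ((c * ρ t / I) • u) - (c * ρ t / I) • f τ u) := by
    rw [intervalIntegral.integral_sub (hint1.intervalIntegrable _ _)
      (hint2.intervalIntegrable _ _), intervalIntegral.integral_smul_const, hmass]
  rw [hsub]
  have hbd : ∀ t, ‖f t ((c * ρ t / I) • u) - (c * ρ t / I) • f τ u‖ ≤
      c * ρ t / I * (η / (c + 1)) := by
    intro t
    have hnn : 0 ≤ c * ρ t / I := by
      have := hρ0 t
      positivity
    rw [map_smul, ← smul_sub, norm_smul, Real.norm_of_nonneg hnn]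
    by_cases ht : |t - τ| < δ
    · gcongr
      rw [← dist_eq_norm]
      exact (hδf (by rwa [Real.dist_eq])).le
    · have : ρ t = 0 := max_eq_left (by linarith)
      simp [this]
  refine (intervalIntegral.norm_integral_le_of_norm_le hT.le (.of_forall fun t _ => hbd t)
    (Continuous.intervalIntegrable (by fun_prop) _ _)).trans ?_
  rw [intervalIntegral.integral_mul_const, hmass, ← mul_div_assoc, div_le_iff₀ (by positivity)]
  nlinarith

/-- Conic combinations of values `f τ u` with `u ∈ U` are approximated by integrals of `f` against
continuous controls with values in a multiple of `U`. -/
theorem exists_continuous_integral_approx (f : ℝ → W →L[ℝ] F) (hf : Continuous f)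
    {U : Set W} (hU : Convex ℝ U) (h0 : (0 : W) ∈ U) {T : ℝ} (hT : 0 < T) (j : ℕ)
    (τ : Fin j → ℝ) (hτ : ∀ i, τ i ∈ Icc 0 T) (u : Fin j → W) (hu : ∀ i, u i ∈ U)
    (c : Fin j → ℝ) (hc : ∀ i, 0 ≤ c i) {η : ℝ} (hη : 0 < η) :
    ∃ (v : ℝ → W) (C : ℝ), Continuous v ∧ 0 ≤ C ∧ (∀ t, v t ∈ C • U) ∧
      ‖(∫ t in (0 : ℝ)..T, f t (v t)) - ∑ i, c i • f (τ i) (u i)‖ ≤ η := by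
  induction j generalizing η with
  | zero => exact ⟨fun _ => 0, 0, continuous_const, le_rfl, fun _ => ⟨0, h0, by simp⟩,
      by simpa using hη.le⟩
  | succ j ih =>
    obtain ⟨v, C, hv, hC, hvC, hvη⟩ := ih (fun i => τ i.castSucc) (fun i => hτ _)
      (fun i => u i.castSucc) (fun i => hu _) (fun i => c i.castSucc) (fun i => hc _) (half_pos hη)
    obtain ⟨v', C', hv', hC', hvC', hvη'⟩ := exists_continuous_integral_approx_smul f hf hU h0 hT
      (hτ (Fin.last j)) (hu (Fin.last j)) (hc (Fin.last j)) (half_pos hη)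
    refine ⟨fun t => v t + v' t, C + C', hv.add hv', add_nonneg hC hC', fun t => ?_, ?_⟩
    · rw [hU.add_smul hC hC']
      exact Set.add_mem_add (hvC t) (hvC' t)
    · simp only [map_add]
      rw [intervalIntegral.integral_add ((hf.clm_apply hv).intervalIntegrable _ _)
        ((hf.clm_apply hv').intervalIntegrable _ _), Fin.sum_univ_castSucc, add_sub_add_comm]
      exact (norm_add_le_of_le hvη hvη').trans (by linarith)

end ApproximateCone

section OpenMapping

variable {ι F : Type*} [Fintype ι] [NormedAddCommGroup F] [NormedSpace ℝ F] [CompleteSpace F]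

/-- If the derivative of `P` at `0` is close to a linear map admitting a nonlinear right
inverse `p`, then `P` maps neighborhoods of `0` within the range of `p` to neighborhoods. -/
theorem HasStrictFDerivAt.image_inter_range_mem_nhds [DecidableEq ι] {P : (ι → ℝ) → F}
    {L : (ι → ℝ) →L[ℝ] F} (hP : HasStrictFDerivAt P L 0) (w : ι → F) (p : F → ι → ℝ)
    (hp : LipschitzWith 1 p) (hp0 : p 0 = 0) (hpw : ∀ y, ∑ i, p y i • w i = y)
    {η : ℝ} (hη : Fintype.card ι * η ≤ 1 / 4) (hL : ∀ i, ‖L (Pi.single i 1) - w i‖ ≤ η)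
    {s : Set (ι → ℝ)} (hs : s ∈ nhds 0) : P '' (s ∩ range p) ∈ nhds (P 0) := by
  obtain ⟨V, hV, hPV⟩ := hP.approximates_deriv_on_nhds (c := 1 / 4) (.inr (by norm_num))
  have hLw : ∀ l : ι → ℝ, ‖L l - ∑ i, l i • w i‖ ≤ 1 / 4 * ‖l‖ := by
    intro l
    have : L l - ∑ i, l i • w i = ∑ i, l i • (L (Pi.single i 1) - w i) := by
      conv_lhs => rw [pi_eq_sum_univ' l]
      simp [smul_sub, Finset.sum_sub_distrib, Pi.single_apply]
    rw [this]
    calc _ ≤ ∑ i, ‖l i • (L (Pi.single i 1) - w i)‖ := norm_sum_le _ _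
      _ ≤ ∑ _i : ι, ‖l‖ * η := by
        gcongr with i
        rw [norm_smul]
        gcongr
        · exact norm_le_pi_norm l i
        · exact hL i
      _ = Fintype.card ι * η * ‖l‖ := by simp; ring
      _ ≤ _ := by gcongr
  have hpc : ContinuousAt p 0 := hp.continuous.continuousAt
  have hH : ApproximatesLinearOn (P ∘ p) (ContinuousLinearMap.id ℝ F) (p ⁻¹' V) (1 / 2) := by
    intro y hy z hz
    have h1 := hPV _ hy _ hz
    have h2 := hLw (p y - p z)
    have h3 : ‖p y - p z‖ ≤ ‖y - z‖ := by simpa [dist_eq_norm] using hp.dist_le_mul y z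
    have h4 : ∑ i, (p y - p z) i • w i = y - z := by
      simp [sub_smul, Finset.sum_sub_distrib, hpw]
    rw [h4] at h2
    push_cast at h1 ⊢
    calc _ = ‖(P (p y) - P (p z) - L (p y - p z)) + (L (p y - p z) - (y - z))‖ := by simp
      _ ≤ 1 / 4 * ‖p y - p z‖ + 1 / 4 * ‖p y - p z‖ := norm_add_le_of_le h1 h2
      _ ≤ _ := by linarith
  have hmap := hH.map_nhds_eq ⟨id, 1, by simp, by simp⟩
    (hpc.preimage_mem_nhds (by rwa [hp0])) (.inr (by norm_num))
  simp only [Function.comp_apply, hp0] at hmap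
  rw [← hmap, Filter.mem_map]
  filter_upwards [hpc.preimage_mem_nhds (t := s) (by rwa [hp0])] with y hy
  exact ⟨p y, ⟨hy, y, rfl⟩, rfl⟩

end OpenMapping

section Orthant

/-- The vectors `e_j` and `-e_j`. -/
def signedBasis (n : ℕ) : Fin n ⊕ Fin n → Ed n :=
  Sum.elim (fun j => EuclideanSpace.single j 1) (fun j => -EuclideanSpace.single j 1)

/-- The positive and negative parts of the coordinates of a vector. -/
def signedParts {n : ℕ} (y : Ed n) : Fin n ⊕ Fin n → ℝ :=
  Sum.elim (fun j => max (y j) 0) (fun j => max (-y j) 0)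

theorem signedParts_nonneg {n : ℕ} (y : Ed n) (i : Fin n ⊕ Fin n) : 0 ≤ signedParts y i := by
  cases i <;> simp [signedParts]

theorem signedParts_zero {n : ℕ} : signedParts (0 : Ed n) = 0 := by
  ext i
  cases i <;> simp [signedParts]

theorem sum_signedParts_smul {n : ℕ} (y : Ed n) :
    ∑ i, signedParts y i • signedBasis n i = y := by
  ext k
  simp only [signedParts, signedBasis, Fintype.sum_sum_type, Sum.elim_inl, Sum.elim_inr, smul_neg,
    Finset.sum_neg_distrib, ← sub_eq_add_neg, ← Finset.sum_sub_distrib, ← sub_smul,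
    max_zero_sub_max_neg_zero_eq_self]
  simp [Pi.single_apply]

theorem lipschitzWith_signedParts {n : ℕ} : LipschitzWith 1 (signedParts (n := n)) := by
  refine LipschitzWith.of_dist_le_mul fun y z => ?_
  simp only [NNReal.coe_one, one_mul, dist_eq_norm]
  refine (pi_norm_le_iff_of_nonneg (norm_nonneg _)).2 fun i => ?_
  rcases i with j | j
  · refine (abs_max_sub_max_le_abs (y j) (z j) 0).trans ?_
    exact PiLp.norm_apply_le (y - z) j
  · refine (abs_max_sub_max_le_abs (-y j) (-z j) 0).trans ?_
    rw [neg_sub_neg, abs_sub_comm]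
    exact PiLp.norm_apply_le (y - z) j

end Orthant

section ControlSystem

variable {d m : ℕ}

theorem contDiff_pushf {φ : ℝ → Ed d → Ed d} {Z : Ed d → Ed d}
    (hφ : ContDiff ℝ (⊤ : ℕ∞) (fun p : ℝ × Ed d => φ p.1 p.2)) (hZ : ContDiff ℝ (⊤ : ℕ∞) Z) :
    ContDiff ℝ 1 (fun p : ℝ × Ed d => pushf φ Z p.1 p.2) := by
  have h1 : ContDiff ℝ (⊤ : ℕ∞)
      (Function.uncurry fun (p : ℝ × Ed d) (y : Ed d) => φ (-p.1) y) :=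
    hφ.comp (f := fun q : (ℝ × Ed d) × Ed d => (-q.1.1, q.2)) (by fun_prop)
  have h2 : ContDiff ℝ 1 (fun p : ℝ × Ed d => φ p.1 p.2) := hφ.of_le (by exact_mod_cast le_top)
  have h3 : ContDiff ℝ 1 Z := hZ.of_le (by exact_mod_cast le_top)
  exact (h1.fderiv h2 (WithTop.coe_le_coe.2 (le_top : (1 + 1 : ℕ∞) ≤ ⊤))).clm_apply (h3.comp h2)

theorem fderiv_flow_pushf {φ : ℝ → Ed d → Ed d} (Z : Ed d → Ed d)
    (hφ : ContDiff ℝ (⊤ : ℕ∞) (fun p : ℝ × Ed d => φ p.1 p.2))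
    (hφ0 : ∀ x, φ 0 x = x) (hφadd : ∀ s t x, φ (s + t) x = φ s (φ t x)) (t : ℝ) (y : Ed d) :
    fderiv ℝ (φ t) y (pushf φ Z t y) = Z (φ t y) := by
  have hdiff : ∀ s, Differentiable ℝ (φ s) := fun s =>
    (hφ.comp (f := fun y : Ed d => (s, y)) (by fun_prop)).differentiable (by simp)
  have hinv : ∀ z, φ t (φ (-t) z) = z := fun z => by rw [← hφadd, add_neg_cancel, hφ0]
  have hinv' : φ (-t) (φ t y) = y := by rw [← hφadd, neg_add_cancel, hφ0]
  have hcomp : HasFDerivAt (fun z => φ t (φ (-t) z))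
      ((fderiv ℝ (φ t) (φ (-t) (φ t y))).comp (fderiv ℝ (φ (-t)) (φ t y))) (φ t y) :=
    (hdiff t _).hasFDerivAt.comp _ (hdiff (-t) _).hasFDerivAt
  simp only [hinv, hinv'] at hcomp
  have := hcomp.unique (hasFDerivAt_id (φ t y))
  simpa [pushf] using congrArg (fun A => A (Z (φ t y))) this

/-- The control-affine vector field pulled back by the drift flow, as a linear map of the
control. -/
def pulledField (φ : ℝ → Ed d → Ed d) (X : Fin m → Ed d → Ed d) (t : ℝ) (y : Ed d) :
    (Fin m → ℝ) →L[ℝ] Ed d :=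
  ∑ k, (ContinuousLinearMap.proj (R := ℝ) (φ := fun _ : Fin m => ℝ) k).smulRight
    (pushf φ (X k) t y)

theorem pulledField_apply (φ : ℝ → Ed d → Ed d) (X : Fin m → Ed d → Ed d) (t : ℝ) (y : Ed d)
    (u : Fin m → ℝ) : pulledField φ X t y u = ∑ k, u k • pushf φ (X k) t y := by
  simp [pulledField, sum_apply]

theorem contDiff_pulledField {φ : ℝ → Ed d → Ed d} {X : Fin m → Ed d → Ed d}
    (hφ : ContDiff ℝ (⊤ : ℕ∞) (fun p : ℝ × Ed d => φ p.1 p.2))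
    (hX : ∀ k, ContDiff ℝ (⊤ : ℕ∞) (X k)) :
    ContDiff ℝ 1 (fun p : ℝ × Ed d => pulledField φ X p.1 p.2) :=
  ContDiff.sum fun k _ => contDiff_const.smulRight (contDiff_pushf hφ (hX k))

/-- A trajectory of the pulled-back system driven by a continuous control is mapped by the drift
flow to a solution of the original system. -/
theorem flow_mem_access {X0 : Ed d → Ed d} {X : Fin m → Ed d → Ed d} {φ : ℝ → Ed d → Ed d}
    (hX0 : ContDiff ℝ (⊤ : ℕ∞) X0) (hX : ∀ k, ContDiff ℝ (⊤ : ℕ∞) (X k))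
    (hφ : ContDiff ℝ (⊤ : ℕ∞) (fun p : ℝ × Ed d => φ p.1 p.2))
    (hφ0 : ∀ x, φ 0 x = x) (hφadd : ∀ s t x, φ (s + t) x = φ s (φ t x))
    (hφder : ∀ t x, HasDerivAt (fun τ => φ τ x) (X0 (φ t x)) t)
    {T : ℝ} (hT : 0 ≤ T) {U : Set (Fin m → ℝ)} {u : ℝ → Fin m → ℝ} (hu : Continuous u)
    (huU : ∀ t ∈ Icc 0 T, u t ∈ U) {y : ℝ → Ed d}
    (hy : ∀ t ∈ Icc 0 T, HasDerivWithinAt y (pulledField φ X t (y t) (u t)) (Icc 0 T) t) :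
    φ T (y T) ∈ Access X0 X U T (y 0) := by
  set x : ℝ → Ed d := fun t => φ t (y t) with hx
  have hx0 : x 0 = y 0 := hφ0 _
  have hder : ∀ t ∈ Icc 0 T,
      HasDerivWithinAt x (X0 (x t) + ∑ k, u t k • X k (x t)) (Icc 0 T) t := by
    intro t ht
    have hΦ : HasFDerivAt (fun p : ℝ × Ed d => φ p.1 p.2)
        (fderiv ℝ (fun p : ℝ × Ed d => φ p.1 p.2) (t, y t)) (t, y t) :=
      (hφ.differentiable (by simp) _).hasFDerivAt
    have h1 : fderiv ℝ (fun p : ℝ × Ed d => φ p.1 p.2) (t, y t) (1, 0) = X0 (x t) :=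
      (hΦ.comp_hasDerivAt (f := fun s => (s, y t)) t
        ((hasDerivAt_id t).prodMk (hasDerivAt_const t (y t)))).unique (hφder t (y t))
    have h2 : ∀ v, fderiv ℝ (fun p : ℝ × Ed d => φ p.1 p.2) (t, y t) (0, v) =
        fderiv ℝ (φ t) (y t) v := by
      intro v
      have := (hΦ.comp (f := fun z => (t, z)) (y t)
        ((hasFDerivAt_const t (y t)).prodMk (hasFDerivAt_id (y t)))).fderiv
      have h3 : (fun p : ℝ × Ed d => φ p.1 p.2) ∘ (fun z => (t, z)) = φ t := rfl
      rw [h3] at this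
      rw [this]
      simp
    have h3 := hΦ.comp_hasDerivWithinAt (f := fun s => (s, y s)) t
      ((hasDerivWithinAt_id t _).prodMk (hy t ht))
    refine h3.congr_deriv ?_
    have h4 : ((1 : ℝ), pulledField φ X t (y t) (u t)) =
        (1, 0) + (0, pulledField φ X t (y t) (u t)) := by simp
    rw [h4, map_add, h1, h2, pulledField_apply, map_sum]
    simp only [map_smul, fderiv_flow_pushf _ hφ hφ0 hφadd, hx]
  have hxc : ContinuousOn x (Icc 0 T) := fun t ht => (hder t ht).continuousWithinAt
  have hrhs : ContinuousOn (fun s => X0 (x s) + ∑ k, u s k • X k (x s)) (Icc 0 T) := by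
    refine (hX0.continuous.comp_continuousOn hxc).add (continuousOn_finsetSum _ fun k _ => ?_)
    exact ((continuous_apply k).comp hu).continuousOn.smul
      ((hX k).continuous.comp_continuousOn hxc)
  obtain ⟨C, hC⟩ := isCompact_Icc.exists_bound_of_continuousOn (hu.continuousOn (s := Icc 0 T))
  have hint : ∀ t ∈ Icc 0 T,
      IntervalIntegrable (fun s => X0 (x s) + ∑ k, u s k • X k (x s)) volume 0 t := by
    intro t ht
    refine ContinuousOn.intervalIntegrable (hrhs.mono ?_)
    rw [uIcc_of_le ht.1]
    exact Icc_subset_Icc_right ht.2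
  refine ⟨x, u, ⟨hu.measurable, huU, ⟨C, hC⟩, ?_, fun t ht => ?_⟩, hx0, rfl⟩
  · exact hint T ⟨hT, le_rfl⟩
  · rw [intervalIntegral.integral_eq_sub_of_hasDerivAt_of_le ht.1
      (hxc.mono (Icc_subset_Icc_right ht.2)) (fun s hs => ?_) (hint t ht)]
    · abel
    · exact (hder s ⟨hs.1.le, hs.2.le.trans ht.2⟩).hasDerivAt
        (Icc_mem_nhds hs.1 (hs.2.trans_le ht.2))

/-- The linear combination, with coefficients given by the parameter, of a family of controls. -/
def combinedControl {ι : Type*} [Fintype ι] (v : ι → ℝ → Fin m → ℝ) (t : ℝ) :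
    (ι → ℝ) →L[ℝ] (Fin m → ℝ) :=
  ∑ i, (ContinuousLinearMap.proj (R := ℝ) (φ := fun _ : ι => ℝ) i).smulRight (v i t)

theorem combinedControl_apply {ι : Type*} [Fintype ι] (v : ι → ℝ → Fin m → ℝ) (t : ℝ)
    (l : ι → ℝ) : combinedControl v t l = ∑ i, l i • v i t := by
  simp [combinedControl, sum_apply]

theorem continuous_combinedControl {ι : Type*} [Fintype ι] {v : ι → ℝ → Fin m → ℝ}
    (hv : ∀ i, Continuous (v i)) : Continuous (combinedControl v) :=
  continuous_finsetSum _ fun i _ =>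
    ((ContinuousLinearMap.smulRightL ℝ (ι → ℝ) (Fin m → ℝ)
      (ContinuousLinearMap.proj i)).continuous).comp (hv i)

/-- Strict differentiability at `0` of the endpoint of the pulled-back system with respect to the
coefficients of a combination of continuous controls. -/
theorem exists_endpoint_hasStrictFDerivAt {ι : Type*} [Fintype ι]
    {X0 : Ed d → Ed d} {X : Fin m → Ed d → Ed d} {φ : ℝ → Ed d → Ed d}
    (hX0 : ContDiff ℝ (⊤ : ℕ∞) X0) (hX : ∀ k, ContDiff ℝ (⊤ : ℕ∞) (X k))
    (hφ : ContDiff ℝ (⊤ : ℕ∞) (fun p : ℝ × Ed d => φ p.1 p.2))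
    (hφ0 : ∀ x, φ 0 x = x) (hφadd : ∀ s t x, φ (s + t) x = φ s (φ t x))
    (hφder : ∀ t x, HasDerivAt (fun τ => φ τ x) (X0 (φ t x)) t)
    {T : ℝ} (hT : 0 < T) (x₀ : Ed d) (v : ι → ℝ → Fin m → ℝ) (hv : ∀ i, Continuous (v i)) :
    ∃ r > 0, ∃ e : (ι → ℝ) → Ed d, e 0 = x₀ ∧
      (∀ l, ‖l‖ ≤ r → ∀ U : Set (Fin m → ℝ), (∀ t ∈ Icc 0 T, ∑ i, l i • v i t ∈ U) →
        φ T (e l) ∈ Access X0 X U T x₀) ∧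
      HasStrictFDerivAt e
        (∫ t in (0 : ℝ)..T, (pulledField φ X t x₀).comp (combinedControl v t)) 0 := by
  have hY := contDiff_pulledField hφ hX
  have hV := continuous_combinedControl hv
  set S : Set (ℝ × Ed d) := Icc 0 T ×ˢ Metric.closedBall x₀ 1 with hS
  have hSc : IsCompact S := isCompact_Icc.prod (isCompact_closedBall _ _)
  have hSconv : Convex ℝ S := (convex_Icc _ _).prod (convex_closedBall _ _)
  obtain ⟨K, hK⟩ := hY.contDiffOn.exists_lipschitzOnWith one_ne_zero hSconv hSc
  obtain ⟨M, hM⟩ := hSc.exists_bound_of_continuousOn hY.continuous.continuousOn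
  obtain ⟨N, hN⟩ := isCompact_Icc.exists_bound_of_continuousOn (hV.continuousOn (s := Icc 0 T))
  have hN' : ∀ t ∈ Icc 0 T, ‖combinedControl v t‖ ≤ N.toNNReal := fun t ht =>
    (hN t ht).trans (Real.le_coe_toNNReal N)
  obtain ⟨r, hr, Y, hYsol, hY0, hYd⟩ := exists_trajectories_hasStrictFDerivAt
    (fun t y => (pulledField φ X t y).comp (combinedControl v t)) x₀ hT
    (fun y => (hY.continuous.comp (f := fun t : ℝ => (t, y)) (by fun_prop)).clm_comp hV)
    (M.toNNReal * N.toNNReal) (K * N.toNNReal)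
    (fun t ht y hy => by
      refine (ContinuousLinearMap.opNorm_comp_le _ _).trans ?_
      push_cast
      gcongr
      · exact (hM (t, y) ⟨ht, hy⟩).trans (Real.le_coe_toNNReal M)
      · exact hN' t ht)
    (fun t ht => LipschitzOnWith.of_dist_le_mul fun y hy z hz => by
      have h1 := hK.dist_le_mul (t, y) ⟨ht, hy⟩ (t, z) ⟨ht, hz⟩
      rw [Prod.dist_eq, dist_self, max_eq_right dist_nonneg, dist_eq_norm] at h1
      rw [dist_eq_norm, ← ContinuousLinearMap.sub_comp]
      calc _ ≤ _ := ContinuousLinearMap.opNorm_comp_le _ _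
        _ ≤ K * dist y z * N.toNNReal := by
          gcongr
          exact hN' t ht
        _ = _ := by push_cast; ring)
  refine ⟨r, hr, fun l => Y l T, hY0, fun l hl U hU => ?_, hYd⟩
  obtain ⟨h0, -, hder⟩ := hYsol l hl
  have := flow_mem_access hX0 hX hφ hφ0 hφadd hφder hT.le (U := U)
    (u := fun t => combinedControl v t l) (hV.clm_apply continuous_const)
    (fun t ht => by simpa only [combinedControl_apply] using hU t ht) (y := Y l) hder
  rwa [h0] at this

end ControlSystem

/-- Theorem 3.5, part II: local controllability with respect to a submersion `π`.
If `Dπ(φ⁰(t_f,x̄₀)) ∘ D_xφ⁰(t_f,·)(x̄₀)` maps `cone Ē` onto `ℝⁿ`, then for every `ε > 0`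
the set `π(A^{εU}_{t_f}(x̄₀))` is a neighborhood of `π(φ⁰(t_f, x̄₀))`. -/
theorem local_controllability_wrt_submersion
    {d n m : ℕ} (hnd : n ≤ d)
    (X0 : Ed d → Ed d) (X : Fin m → Ed d → Ed d) (U : Set (Fin m → ℝ))
    (hX0 : ContDiff ℝ (⊤ : ℕ∞) X0) (hX : ∀ k, ContDiff ℝ (⊤ : ℕ∞) (X k))
    (hUconv : Convex ℝ U) (hUcomp : IsCompact U) (hU0 : (0 : Fin m → ℝ) ∈ U)
    (φ : ℝ → Ed d → Ed d)
    (hφsmooth : ContDiff ℝ (⊤ : ℕ∞) (fun p : ℝ × Ed d => φ p.1 p.2))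
    (hφ0 : ∀ x, φ 0 x = x)
    (hφadd : ∀ s t x, φ (s + t) x = φ s (φ t x))
    (hφder : ∀ t x, HasDerivAt (fun τ => φ τ x) (X0 (φ t x)) t)
    (π : Ed d → Ed n)
    (hπ : ContDiff ℝ (⊤ : ℕ∞) π)
    (hπsub : ∀ x : Ed d, Function.Surjective (fderiv ℝ π x))
    (tf : ℝ) (htf : 0 < tf) (xbar0 : Ed d)
    (hcone : (fun v => fderiv ℝ π (φ tf xbar0) (fderiv ℝ (fun y => φ tf y) xbar0 v)) ''
        coneHull (EIcc φ X U 0 tf xbar0) = univ) :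
    ∀ ε : ℝ, 0 < ε → π '' Access X0 X (ε • U) tf xbar0 ∈ nhds (π (φ tf xbar0)) := by
  intro ε hε
  set A : Ed d →L[ℝ] Ed n :=
    (fderiv ℝ π (φ tf xbar0)).comp (fderiv ℝ (fun y => φ tf y) xbar0) with hA
  set f : ℝ → (Fin m → ℝ) →L[ℝ] Ed n := fun t => A.comp (pulledField φ X t xbar0) with hf
  have hY : Continuous fun t => pulledField φ X t xbar0 :=
    (contDiff_pulledField hφsmooth hX).continuous.comp (f := fun t : ℝ => (t, xbar0)) (by fun_prop)
  have hfc : Continuous f := continuous_const.clm_comp hY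
  obtain ⟨η, hη, hηn⟩ : ∃ η > 0, Fintype.card (Fin n ⊕ Fin n) * η ≤ (1 / 4 : ℝ) := by
    refine ⟨(4 * (Fintype.card (Fin n ⊕ Fin n) + 1))⁻¹, by positivity, ?_⟩
    rw [← div_eq_mul_inv, div_le_div_iff₀ (by positivity) (by norm_num)]
    linarith
  have happrox : ∀ i, ∃ (v : ℝ → Fin m → ℝ) (C : ℝ), Continuous v ∧ 0 ≤ C ∧
      (∀ t, v t ∈ C • U) ∧ ‖(∫ t in (0 : ℝ)..tf, f t (v t)) - signedBasis n i‖ ≤ η := by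
    intro i
    obtain ⟨_, ⟨j, w, c, hw, hc, rfl⟩, hsum⟩ : signedBasis n i ∈
        (fun v => fderiv ℝ π (φ tf xbar0) (fderiv ℝ (fun y => φ tf y) xbar0 v)) ''
          coneHull (EIcc φ X U 0 tf xbar0) := hcone ▸ mem_univ _
    simp only [EIcc, EsetAt, mem_iUnion, mem_ofPred_eq, exists_prop] at hw
    choose τ hτ u hu hwu using hw
    obtain ⟨v, C, hv, hC, hvC, hvη⟩ :=
      exists_continuous_integral_approx f hfc hUconv hU0 htf j τ hτ u hu c hc hη
    refine ⟨v, C, hv, hC, hvC, ?_⟩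
    have hsum' : signedBasis n i = ∑ k, c k • f (τ k) (u k) := by
      rw [← hsum]
      simp [hf, hA, pulledField_apply, hwu]
    rw [hsum']
    exact hvη
  choose v C hv hC hvC hvη using happrox
  obtain ⟨r, hr, e, he0, heA, hed⟩ := exists_endpoint_hasStrictFDerivAt hX0 hX hφsmooth hφ0 hφadd
    hφder htf xbar0 v hv
  have hflow : ContDiff ℝ (⊤ : ℕ∞) (fun y => φ tf y) :=
    hφsmooth.comp (f := fun y : Ed d => (tf, y)) (by fun_prop)
  have hP : HasStrictFDerivAt (fun l => π (φ tf (e l)))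
      (A.comp (∫ t in (0 : ℝ)..tf, (pulledField φ X t xbar0).comp (combinedControl v t))) 0 := by
    have h1 : HasStrictFDerivAt (fun y => π (φ tf y)) A (e 0) := by
      rw [he0]
      exact (hπ.contDiffAt.hasStrictFDerivAt (by simp)).comp xbar0
        (hflow.contDiffAt.hasStrictFDerivAt (by simp))
    exact h1.comp 0 hed
  have hL : ∀ i, ‖(A.comp (∫ t in (0 : ℝ)..tf,
      (pulledField φ X t xbar0).comp (combinedControl v t))) (Pi.single i 1) -
        signedBasis n i‖ ≤ η := by
    intro i
    have hG : Continuous fun t => (pulledField φ X t xbar0).comp (combinedControl v t) :=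
      hY.clm_comp (continuous_combinedControl hv)
    convert hvη i using 3
    rw [ContinuousLinearMap.comp_apply,
      ContinuousLinearMap.intervalIntegral_apply (hG.intervalIntegrable _ _),
      ← ContinuousLinearMap.intervalIntegral_comp_comm _
        ((hG.clm_apply continuous_const).intervalIntegrable _ _)]
    simp [hf, combinedControl_apply, Pi.single_apply]
  have hs : {l : Fin n ⊕ Fin n → ℝ | ‖l‖ ≤ r ∧ ∑ i, l i * C i ≤ ε} ∈ nhds 0 := by
    have h1 : ∀ᶠ l : Fin n ⊕ Fin n → ℝ in nhds 0, ‖l‖ < r :=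
      continuous_norm.continuousAt.eventually_lt continuousAt_const (by simpa using hr)
    have h2 : ∀ᶠ l : Fin n ⊕ Fin n → ℝ in nhds 0, ∑ i, l i * C i < ε :=
      (show Continuous fun l : Fin n ⊕ Fin n → ℝ => ∑ i, l i * C i by
        fun_prop).continuousAt.eventually_lt continuousAt_const (by simpa using hε)
    filter_upwards [h1, h2] with l hl hl' using ⟨hl.le, hl'.le⟩
  have hmem := hP.image_inter_range_mem_nhds (signedBasis n) signedParts lipschitzWith_signedParts
    signedParts_zero sum_signedParts_smul hηn hL hs
  simp only [he0] at hmem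
  refine Filter.mem_of_superset hmem ?_
  rintro _ ⟨_, ⟨⟨hlr, hlε⟩, y, rfl⟩, rfl⟩
  refine ⟨_, heA _ hlr (ε • U) fun t _ => ?_, rfl⟩
  have hnn : ∀ i, 0 ≤ signedParts y i * C i := fun i => mul_nonneg (signedParts_nonneg y i) (hC i)
  refine hUconv.smul_subset_smul_of_le hU0 (Finset.sum_nonneg fun i _ => hnn i) hlε
    (hUconv.sum_mem_sum_smul hU0 _ _ _ (fun i _ => hnn i) fun i _ => ?_)
  rw [mul_smul]
  exact smul_mem_smul_set (hvC i t)
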